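/- Let m ≥ 2 be a natural number and let (A,+,·) be a left brace with A^{(3)} = {0} and A^{m+1} = {0}. Let a ∈ A, define a_1 = a, a_{j+1} = a*a_j for j ≥ 1, and let S be the subbrace of A generated by a (equal to the set of all ∑_{k=1}^m t_k·a_k with t_k ∈ ℤ). Then for every r with 1 ≤ r ≤ m, the r-th term S^r of the left series of the brace S equals {∑_{k=r}^m t_k·a_k : t_r,…,t_m ∈ ℤ}, and S^r = {0} for r ≥ m+1. -/

import Mathlib

/-- `λ_a(b) = -a + a·b` for a left-brace multiplication `mul`. -/
def braceLam {A : Type*} [AddCommGroup A] (mul : A → A → A) (a b : A) : A :=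
  -a + mul a b

/-- The star operation `a * b = λ_a(b) - b`. -/
def braceStar {A : Type*} [AddCommGroup A] (mul : A → A → A) (a b : A) : A :=
  braceLam mul a b - b

/-- `rightSeries mul r` is `A^{(r+1)}` of the paper: `rightSeries mul 0 = A^{(1)} = A` and
`rightSeries mul (r+1) = A^{(r+2)} = A^{(r+1)} * A`, the additive subgroup generated by
star products of elements of `A^{(r+1)}` with elements of `A`. -/
def rightSeries {A : Type*} [AddCommGroup A] (mul : A → A → A) : ℕ → AddSubgroup A
  | 0 => ⊤
  | r + 1 => AddSubgroup.closure {x | ∃ z c, z ∈ rightSeries mul r ∧ x = braceStar mul z c}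

/-- `leftSeries mul r` is `A^{r+1}` of the paper: `leftSeries mul 0 = A^1 = A` and
`leftSeries mul (r+1) = A^{r+2} = A * A^{r+1}`, the additive subgroup generated by
star products of elements of `A` with elements of `A^{r+1}`. -/
def leftSeries {A : Type*} [AddCommGroup A] (mul : A → A → A) : ℕ → AddSubgroup A
  | 0 => ⊤
  | r + 1 => AddSubgroup.closure {x | ∃ c z, z ∈ leftSeries mul r ∧ x = braceStar mul c z}

section BraceIdentities

variable {A : Type*} [AddCommGroup A] {mul : A → A → A}

theorem braceLam_eq_add_braceStar (mul : A → A → A) (x y : A) :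
    braceLam mul x y = y + braceStar mul x y := by
  simp [braceStar]

theorem braceLam_add (hdist : ∀ a b c : A, mul a (b + c) = mul a b - a + mul a c) (x y z : A) :
    braceLam mul x (y + z) = braceLam mul x y + braceLam mul x z := by
  simp only [braceLam, hdist]
  abel

theorem braceLam_zero (hzr : ∀ a : A, mul a 0 = a) (x : A) : braceLam mul x 0 = 0 := by
  simp [braceLam, hzr]

theorem braceLam_neg (hzr : ∀ a : A, mul a 0 = a)
    (hdist : ∀ a b c : A, mul a (b + c) = mul a b - a + mul a c) (x y : A) :
    braceLam mul x (-y) = -braceLam mul x y := by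
  have h := braceLam_add hdist x (-y) y
  rw [neg_add_cancel, braceLam_zero hzr] at h
  exact eq_neg_of_add_eq_zero_left h.symm

theorem braceLam_mul (hassoc : ∀ a b c : A, mul (mul a b) c = mul a (mul b c))
    (hzr : ∀ a : A, mul a 0 = a)
    (hdist : ∀ a b c : A, mul a (b + c) = mul a b - a + mul a c) (x y z : A) :
    braceLam mul (mul x y) z = braceLam mul x (braceLam mul y z) := by
  have h : braceLam mul x (braceLam mul y z) =
      -braceLam mul x y + braceLam mul x (mul y z) := by
    rw [← braceLam_neg hzr hdist, ← braceLam_add hdist]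
    rfl
  rw [h]
  simp only [braceLam, hassoc]
  abel

theorem braceStar_add (hdist : ∀ a b c : A, mul a (b + c) = mul a b - a + mul a c) (x y z : A) :
    braceStar mul x (y + z) = braceStar mul x y + braceStar mul x z := by
  simp only [braceStar, braceLam_add hdist]
  abel

theorem braceStar_zero (hzr : ∀ a : A, mul a 0 = a) (x : A) : braceStar mul x 0 = 0 := by
  simp [braceStar, braceLam_zero hzr]

theorem braceStar_neg (hzr : ∀ a : A, mul a 0 = a)
    (hdist : ∀ a b c : A, mul a (b + c) = mul a b - a + mul a c) (x y : A) :
    braceStar mul x (-y) = -braceStar mul x y := by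
  simp only [braceStar, braceLam_neg hzr hdist]
  abel

theorem braceStar_mem_rightSeries_one (x y : A) : braceStar mul x y ∈ rightSeries mul 1 :=
  AddSubgroup.subset_closure ⟨x, y, AddSubgroup.mem_top x, rfl⟩

theorem braceStar_eq_zero_of_mem_rightSeries_one (h3 : rightSeries mul 2 = ⊥) {z : A}
    (hz : z ∈ rightSeries mul 1) (y : A) : braceStar mul z y = 0 := by
  have h : braceStar mul z y ∈ rightSeries mul 2 :=
    AddSubgroup.subset_closure ⟨z, y, hz, rfl⟩
  rwa [h3, AddSubgroup.mem_bot] at h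

/-- If `A^{(3)} = 0` then `λ` turns sums into compositions. -/
theorem braceLam_add_left (hassoc : ∀ a b c : A, mul (mul a b) c = mul a (mul b c))
    (hzl : ∀ a : A, mul 0 a = a) (hzr : ∀ a : A, mul a 0 = a)
    (hinv : ∀ a : A, ∃ b : A, mul a b = 0 ∧ mul b a = 0)
    (hdist : ∀ a b c : A, mul a (b + c) = mul a b - a + mul a c)
    (h3 : rightSeries mul 2 = ⊥) (x y t : A) :
    braceLam mul (x + y) t = braceLam mul x (braceLam mul y t) := by
  obtain ⟨b, hb, -⟩ := hinv x
  obtain ⟨w, hw⟩ : ∃ w, mul x w = x + y := ⟨mul b (x + y), by rw [← hassoc, hb, hzl]⟩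
  have hstar : y = w + braceStar mul x w := by
    simp [braceStar, braceLam, hw]
  have hz : -braceStar mul x w ∈ rightSeries mul 1 :=
    neg_mem (braceStar_mem_rightSeries_one x w)
  have hlam (u : A) : braceLam mul (-braceStar mul x w) u = u := by
    rw [braceLam_eq_add_braceStar, braceStar_eq_zero_of_mem_rightSeries_one h3 hz, add_zero]
  have hmul : mul (-braceStar mul x w) y = w := by
    have h := hlam y
    rw [braceLam, neg_add_eq_iff_eq_add] at h
    rw [h, neg_add_eq_iff_eq_add, add_comm]
    exact hstar
  rw [← hw, braceLam_mul hassoc hzr hdist]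
  conv_lhs => rw [← hmul, braceLam_mul hassoc hzr hdist, hlam]

end BraceIdentities

/-- The elements whose star action shifts a filtration that is eventually zero form an additive
subgroup when `λ` turns sums into compositions. -/
theorem braceStar_mem_of_mem_closure {A : Type*} [AddCommGroup A] {mul : A → A → A}
    (hzl : ∀ a : A, mul 0 a = a) (hzr : ∀ a : A, mul a 0 = a)
    (hdist : ∀ a b c : A, mul a (b + c) = mul a b - a + mul a c)
    (hlam : ∀ x y t : A, braceLam mul (x + y) t = braceLam mul x (braceLam mul y t))
    (F : ℕ → AddSubgroup A) (hF : Antitone F) {n : ℕ} (hn : F n = ⊥) {X : Set A}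
    (hX : ∀ x ∈ X, ∀ r, 1 ≤ r → ∀ t ∈ F r, braceStar mul x t ∈ F (r + 1)) {s : A}
    (hs : s ∈ AddSubgroup.closure X) :
    ∀ r, 1 ≤ r → ∀ t ∈ F r, braceStar mul s t ∈ F (r + 1) := by
  have hlam0 (t : A) : braceLam mul 0 t = t := by simp [braceLam, hzl]
  induction hs using AddSubgroup.closure_induction with
  | mem x hx => exact hX x hx
  | zero =>
    intro r _ t _
    simp [braceStar, hlam0]
  | add x y _ _ ihx ihy =>
    intro r hr t ht
    have hy := ihy r hr t ht
    have hyt : braceLam mul y t ∈ F r := by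
      rw [braceLam_eq_add_braceStar]
      exact add_mem ht (hF (Nat.le_succ r) hy)
    have h : braceStar mul (x + y) t =
        braceStar mul x (braceLam mul y t) + braceStar mul y t := by
      simp [braceStar, hlam]
    rw [h]
    exact add_mem (ihx r hr _ hyt) hy
  | neg x _ ih =>
    have key (r : ℕ) (t : A) :
        braceLam mul (-x) t = t - braceLam mul (-x) (braceStar mul x t) := by
      have h := hlam (-x) x t
      rw [neg_add_cancel, hlam0, braceLam_eq_add_braceStar mul x, braceLam_add hdist] at h
      exact eq_sub_of_add_eq h.symm
    have stable (d : ℕ) : ∀ r, 1 ≤ r → n ≤ r + d → ∀ t ∈ F r, braceLam mul (-x) t ∈ F r := by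
      induction d with
      | zero =>
        intro r _ hnr t ht
        have ht0 : t = 0 := by
          have := hF hnr ht
          rwa [hn, AddSubgroup.mem_bot] at this
        rw [ht0, braceLam_zero hzr]
        exact zero_mem _
      | succ d ihd =>
        intro r hr hnr t ht
        rw [key r t]
        exact sub_mem ht (hF (Nat.le_succ r)
          (ihd (r + 1) (by omega) (by omega) _ (ih r hr t ht)))
    intro r hr t ht
    have h : braceStar mul (-x) t = -braceLam mul (-x) (braceStar mul x t) := by
      rw [braceStar, key r t]
      abel
    rw [h]
    exact neg_mem (stable n (r + 1) (by omega) (by omega) _ (ih r hr t ht))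

theorem coe_closure_image_Ici_eq_sums {A : Type*} [AddCommGroup A] (f : ℕ → A) {m r : ℕ}
    (hf : ∀ k, m < k → f k = 0) :
    (AddSubgroup.closure (f '' Set.Ici r) : Set A) =
      {x | ∃ t : ℕ → ℤ, x = ∑ k ∈ Finset.Icc r m, t k • f k} := by
  ext x
  constructor
  · intro hx
    induction hx using AddSubgroup.closure_induction with
    | mem x hx =>
      obtain ⟨k, hk, rfl⟩ := hx
      refine ⟨Pi.single k 1, ?_⟩
      by_cases hkm : k ≤ m
      · rw [Finset.sum_eq_single_of_mem k (Finset.mem_Icc.2 ⟨hk, hkm⟩)]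
        · simp
        · intro j _ hj
          simp [hj]
      · rw [hf k (by omega), Finset.sum_eq_zero]
        intro j hj
        have hjk : j ≠ k := by
          have := (Finset.mem_Icc.1 hj).2
          omega
        simp [hjk]
    | zero => exact ⟨0, by simp⟩
    | add x y _ _ hx hy =>
      obtain ⟨t, rfl⟩ := hx
      obtain ⟨u, rfl⟩ := hy
      exact ⟨t + u, by simp [add_smul, Finset.sum_add_distrib]⟩
    | neg x _ hx =>
      obtain ⟨t, rfl⟩ := hx
      exact ⟨-t, by simp [neg_smul]⟩
  · rintro ⟨t, rfl⟩
    refine sum_mem fun k hk => zsmul_mem (AddSubgroup.subset_closure ?_) _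
    exact ⟨k, (Finset.mem_Icc.1 hk).1, rfl⟩

/-- Let `m ≥ 2`, `A` a left brace with `A^{(3)} = A^{m+1} = {0}`, `a ∈ A`,
`a_1 = a`, `a_{j+1} = a * a_j`, and let `S` be the subbrace of `A` generated by `a`, which
equals `{∑_{k=1}^m t_k·a_k : t_k ∈ ℤ}`.  Let `SL` be the left series of the brace `S`:
`SL 0 = S^1 = S` (as an additive subgroup) and `SL r = S^{r+1}` is the additive subgroup
generated by `{s * t : s ∈ S, t ∈ S^r}`.  Then for `1 ≤ r ≤ m`,
`S^r = {∑_{k=r}^m t_k·a_k : t_k ∈ ℤ}`, and `S^r = {0}` for `r ≥ m + 1`. -/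
theorem stmt15 {A : Type*} [AddCommGroup A] (m : ℕ) (hm : 2 ≤ m)
    (mul : A → A → A)
    (hassoc : ∀ a b c : A, mul (mul a b) c = mul a (mul b c))
    (hzl : ∀ a : A, mul 0 a = a)
    (hzr : ∀ a : A, mul a 0 = a)
    (hinv : ∀ a : A, ∃ b : A, mul a b = 0 ∧ mul b a = 0)
    (hdist : ∀ a b c : A, mul a (b + c) = mul a b - a + mul a c)
    (h3 : rightSeries mul 2 = ⊥) (hL : leftSeries mul m = ⊥)
    (a : A) (f : ℕ → A) (hf1 : f 1 = a)
    (hf : ∀ j : ℕ, 1 ≤ j → f (j + 1) = braceStar mul a (f j))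
    (S : Set A) (hS : S = {x | ∃ t : ℕ → ℤ, x = ∑ k ∈ Finset.Icc 1 m, t k • f k})
    (SL : ℕ → AddSubgroup A) (hSL0 : SL 0 = AddSubgroup.closure S)
    (hSLsucc : ∀ r : ℕ,
      SL (r + 1) = AddSubgroup.closure {x | ∃ s ∈ S, ∃ t ∈ SL r, x = braceStar mul s t}) :
    (∀ r : ℕ, 1 ≤ r → r ≤ m →
      (SL (r - 1) : Set A) = {x | ∃ t : ℕ → ℤ, x = ∑ k ∈ Finset.Icc r m, t k • f k}) ∧
    (∀ r : ℕ, m + 1 ≤ r → SL (r - 1) = ⊥) := by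
  have hmem (k : ℕ) : f (k + 1) ∈ leftSeries mul k := by
    induction k with
    | zero => exact AddSubgroup.mem_top _
    | succ k ih =>
      exact AddSubgroup.subset_closure ⟨a, f (k + 1), ih, hf (k + 1) (by omega)⟩
  have hf0 : ∀ k, m < k → f k = 0 := by
    intro k hk
    induction k, hk using Nat.le_induction with
    | base =>
      have := hmem m
      rwa [hL, AddSubgroup.mem_bot] at this
    | succ k hk ih => rw [hf k (by omega), ih, braceStar_zero hzr]
  set F : ℕ → AddSubgroup A := fun r => AddSubgroup.closure (f '' Set.Ici r) with hFdef
  have hfF {r k : ℕ} (h : r ≤ k) : f k ∈ F r := AddSubgroup.subset_closure ⟨k, h, rfl⟩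
  have hFanti : Antitone F := fun r s hrs =>
    AddSubgroup.closure_mono (Set.image_mono (Set.Ici_subset_Ici.2 hrs))
  have hFbot {r : ℕ} (hr : m < r) : F r = ⊥ := by
    rw [hFdef, AddSubgroup.closure_eq_bot_iff]
    rintro _ ⟨k, hk, rfl⟩
    exact hf0 k (lt_of_lt_of_le hr hk)
  have hSF : S = F 1 := by rw [hS, coe_closure_image_Ici_eq_sums f hf0]
  have hshift : ∀ s ∈ F 1, ∀ r, 1 ≤ r → ∀ t ∈ F r, braceStar mul s t ∈ F (r + 1) := by
    intro s hs
    refine braceStar_mem_of_mem_closure hzl hzr hdist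
      (braceLam_add_left hassoc hzl hzr hinv hdist h3) F hFanti (hFbot (Nat.lt_succ_self m)) ?_ hs
    rintro _ ⟨k, hk, rfl⟩ r hr t ht
    obtain rfl | hk1 := eq_or_lt_of_le (Set.mem_Ici.1 hk)
    · rw [hf1]
      induction ht using AddSubgroup.closure_induction with
      | mem t ht =>
        obtain ⟨j, hj, rfl⟩ := ht
        have hj' : r ≤ j := hj
        rw [← hf j (by omega)]
        exact hfF (by omega)
      | zero =>
        rw [braceStar_zero hzr]
        exact zero_mem _
      | add x y _ _ hx hy =>
        rw [braceStar_add hdist]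
        exact add_mem hx hy
      | neg x _ hx =>
        rw [braceStar_neg hzr hdist]
        exact neg_mem hx
    · obtain ⟨j, rfl⟩ := Nat.exists_eq_add_of_lt hk1
      have hfk : f (1 + j + 1) ∈ rightSeries mul 1 := by
        rw [hf (1 + j) (by omega)]
        exact braceStar_mem_rightSeries_one _ _
      rw [braceStar_eq_zero_of_mem_rightSeries_one h3 hfk]
      exact zero_mem _
  have hSL (r : ℕ) : SL r = F (r + 1) := by
    induction r with
    | zero => rw [hSL0, hSF, AddSubgroup.closure_eq]
    | succ r ih =>
      rw [hSLsucc, ih, hSF]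
      apply le_antisymm
      · rw [AddSubgroup.closure_le]
        rintro _ ⟨s, hs, t, ht, rfl⟩
        exact hshift s hs (r + 1) (by omega) t ht
      · refine (AddSubgroup.closure_le _).2 ?_
        rintro _ ⟨k, hk, rfl⟩
        have hk' : r + 1 + 1 ≤ k := hk
        obtain ⟨j, rfl⟩ := Nat.exists_eq_add_of_le' (show 1 ≤ k by omega)
        refine AddSubgroup.subset_closure
          ⟨a, ?_, f j, hfF (by omega), hf j (by omega)⟩
        rw [← hf1]
        exact hfF le_rfl
  constructor
  · intro r hr _
    rw [hSL, Nat.sub_add_cancel hr]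
    exact coe_closure_image_Ici_eq_sums f hf0
  · intro r hr
    rw [hSL, hFbot (by omega)]
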